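/- arXiv:2409.04032 — 2 statements merged into one kernel-verified Lean document; each statement's English description precedes it below -/
import Mathlib

section
/- With θ = 2π/5 and c = (32(5+3√5)/125)·sin θ, the following identity of polynomials in ℝ[x,y] holds: l₆·l₇·l₈·l₉·l₁₀ = c⁻¹·P₁, i.e. the product of the five 'red' affine linear forms equals c⁻¹ times the quintic P₁. -/
open MvPolynomial

/-- The quintic `P₁` (defining the five red lines of the double star arrangement),
as an element of `ℝ[x,y]`. -/
noncomputable def P₁ : MvPolynomial (Fin 2) ℝ :=
  C (2/5) * X 0 ^ 5 - C 4 * X 0 ^ 3 * X 1 ^ 2 + C 2 * X 0 * X 1 ^ 4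
    + C ((1 + Real.sqrt 5)/2) * X 0 ^ 4 + C (1 + Real.sqrt 5) * X 0 ^ 2 * X 1 ^ 2
    + C ((1 + Real.sqrt 5)/2) * X 1 ^ 4
    - C (2 + Real.sqrt 5) * X 0 ^ 2 - C (2 + Real.sqrt 5) * X 1 ^ 2
    + C ((11 + 5 * Real.sqrt 5)/10)

/-- The constant `c = (32(5+3√5)/125)·sin(2π/5)`. -/
noncomputable def cDS : ℝ := 32 * (5 + 3 * Real.sqrt 5) / 125 * Real.sin (2 * Real.pi / 5)

/-- θ = 2π/5. -/
noncomputable def θDS : ℝ := 2 * Real.pi / 5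

/-- The five "red" affine linear forms `l₆, …, l₁₀` in `ℝ[x,y]`. -/
noncomputable def l₆ : MvPolynomial (Fin 2) ℝ :=
  C (Real.sin (2 * θDS) - Real.sin θDS) * X 0 + C (Real.cos (2 * θDS) - Real.cos θDS) * X 1
    - C (Real.sin θDS)

noncomputable def l₇ : MvPolynomial (Fin 2) ℝ :=
  C (-Real.sin θDS) * X 0 + C (Real.cos θDS - 1) * X 1 + C (Real.sin θDS)

noncomputable def l₈ : MvPolynomial (Fin 2) ℝ :=
  C (2 * Real.sin (2 * θDS)) * X 0 + C (Real.sin θDS)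

noncomputable def l₉ : MvPolynomial (Fin 2) ℝ :=
  C (Real.sin θDS) * X 0 + C (Real.cos θDS - 1) * X 1 - C (Real.sin θDS)

noncomputable def l₁₀ : MvPolynomial (Fin 2) ℝ :=
  C (-(Real.sin (2 * θDS) - Real.sin θDS)) * X 0 + C (Real.cos (2 * θDS) - Real.cos θDS) * X 1
    + C (Real.sin θDS)

theorem cos_θDS : Real.cos θDS = (Real.sqrt 5 - 1) / 4 := by
  have h5 : Real.sqrt 5 ^ 2 = 5 := Real.sq_sqrt (by norm_num)
  have h : θDS = 2 * (Real.pi / 5) := by unfold θDS; ring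
  rw [h, Real.cos_two_mul, Real.cos_pi_div_five]
  linear_combination h5 / 8

theorem cos_two_mul_θDS : Real.cos (2 * θDS) = -(Real.sqrt 5 + 1) / 4 := by
  have h5 : Real.sqrt 5 ^ 2 = 5 := Real.sq_sqrt (by norm_num)
  rw [Real.cos_two_mul, cos_θDS]
  linear_combination h5 / 8

theorem sin_two_mul_θDS : Real.sin (2 * θDS) = Real.sin θDS * (Real.sqrt 5 - 1) / 2 := by
  rw [Real.sin_two_mul, cos_θDS]
  ring

theorem sin_θDS_sq : Real.sin θDS ^ 2 = (5 + Real.sqrt 5) / 8 := by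
  have h5 : Real.sqrt 5 ^ 2 = 5 := Real.sq_sqrt (by norm_num)
  rw [Real.sin_sq, cos_θDS]
  linear_combination -h5 / 16

theorem cDS_inv : cDS⁻¹ = 25 * (Real.sqrt 5 - 2) / 16 * Real.sin θDS := by
  have h5 : Real.sqrt 5 ^ 2 = 5 := Real.sq_sqrt (by norm_num)
  have hs := sin_θDS_sq
  have hc : cDS = 32 * (5 + 3 * Real.sqrt 5) / 125 * Real.sin θDS := rfl
  refine inv_eq_of_mul_eq_one_right ?_
  rw [hc]
  generalize Real.sqrt 5 = r at *
  generalize Real.sin θDS = s at *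
  grind

/-- The product of the five red affine linear forms equals `c⁻¹ · P₁` in `ℝ[x,y]`. -/
theorem red_product_eq : l₆ * l₇ * l₈ * l₉ * l₁₀ = C cDS⁻¹ * P₁ := by
  have h5 : Real.sqrt 5 ^ 2 = 5 := Real.sq_sqrt (by norm_num)
  have hs := sin_θDS_sq
  refine MvPolynomial.funext fun v => ?_
  simp only [l₆, l₇, l₈, l₉, l₁₀, P₁, cDS_inv, cos_θDS, cos_two_mul_θDS, sin_two_mul_θDS,
    map_add, map_sub, map_mul, map_pow, eval_C, eval_X]
  generalize Real.sqrt 5 = r at *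
  generalize Real.sin θDS = s at *
  generalize v 0 = x
  generalize v 1 = y
  grind
end

section
/- For every complex number λ with λ ≠ 0, there exists a point (x,y) ∈ ℂ² such that P₂(x,y) ≠ 0 and P₁(x,y) = λ·P₂(x,y). (In other words, the rational map h = P₁/P₂ is surjective from the complement of the zero locus of P₁·P₂ in ℂ² onto ℂ*.) -/
/-- The quintic `P₁` as a polynomial function on `ℂ²`. -/
noncomputable def p₁ (x y : ℂ) : ℂ :=
  (2/5) * x ^ 5 - 4 * x ^ 3 * y ^ 2 + 2 * x * y ^ 4
    + ((1 + (Real.sqrt 5 : ℂ))/2) * x ^ 4 + (1 + (Real.sqrt 5 : ℂ)) * x ^ 2 * y ^ 2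
    + ((1 + (Real.sqrt 5 : ℂ))/2) * y ^ 4
    - (2 + (Real.sqrt 5 : ℂ)) * x ^ 2 - (2 + (Real.sqrt 5 : ℂ)) * y ^ 2
    + (11 + 5 * (Real.sqrt 5 : ℂ))/10

/-- The quintic `P₂` as a polynomial function on `ℂ²`. -/
noncomputable def p₂ (x y : ℂ) : ℂ :=
  (2/5) * x ^ 5 - 4 * x ^ 3 * y ^ 2 + 2 * x * y ^ 4
    + ((1 - (Real.sqrt 5 : ℂ))/2) * x ^ 4 + (1 - (Real.sqrt 5 : ℂ)) * x ^ 2 * y ^ 2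
    + ((1 - (Real.sqrt 5 : ℂ))/2) * y ^ 4
    - (2 - (Real.sqrt 5 : ℂ)) * x ^ 2 - (2 - (Real.sqrt 5 : ℂ)) * y ^ 2
    + (11 - 5 * (Real.sqrt 5 : ℂ))/10

/-- Over an algebraically closed field of characteristic not two, a quadratic expression whose
two highest coefficients do not both vanish has a root. -/
theorem exists_root_quadratic {K : Type*} [Field K] [IsAlgClosed K] [NeZero (2 : K)] {a b : K}
    (c : K) (hab : a = 0 → b ≠ 0) : ∃ t : K, a * (t * t) + b * t + c = 0 := by
  by_cases ha : a = 0
  · refine ⟨-c / b, ?_⟩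
    have hb := hab ha
    rw [ha]
    field_simp
    ring
  · obtain ⟨d, hd⟩ := IsAlgClosed.exists_eq_mul_self (discrim a b c)
    exact exists_quadratic_eq_zero ha ⟨d, hd⟩

theorem p₁_sub_p₂ (x y : ℂ) :
    p₁ x y - p₂ x y = (Real.sqrt 5 : ℂ) * (x ^ 2 + y ^ 2 - 1) ^ 2 := by
  unfold p₁ p₂
  ring

theorem ofReal_sqrt_five_sq : (Real.sqrt 5 : ℂ) ^ 2 = 5 := by
  rw [← Complex.ofReal_pow, Real.sq_sqrt (by norm_num)]
  norm_num

theorem ofReal_sqrt_five_ne_zero : (Real.sqrt 5 : ℂ) ≠ 0 := by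
  intro h
  have h5 := ofReal_sqrt_five_sq
  norm_num [h] at h5

/-- `P₁` and `P₂` have no common zero on the line `x = 0`. -/
theorem p₁_ne_zero_of_p₂_eq_zero {y : ℂ} (h₂ : p₂ 0 y = 0) : p₁ 0 y ≠ 0 := by
  intro h₁
  have h := p₁_sub_p₂ 0 y
  rw [h₁, h₂, sub_zero, eq_comm, mul_eq_zero, or_iff_right ofReal_sqrt_five_ne_zero,
    sq_eq_zero_iff] at h
  have hy : y ^ 2 = 1 := by linear_combination h
  have hval : p₂ 0 y = -2 / 5 := by
    unfold p₂
    linear_combination ((1 - (Real.sqrt 5 : ℂ)) / 2 * (y ^ 2 + 1) - (2 - (Real.sqrt 5 : ℂ))) * hy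
  norm_num [hval] at h₂

/-- For every `λ ≠ 0` there is a point of `ℂ²` with `P₂ ≠ 0` and `P₁ = λ·P₂`; i.e. the
map `h = P₁/P₂` is surjective onto `ℂ*`. -/
theorem h_surjective (lam : ℂ) (hlam : lam ≠ 0) :
    ∃ x y : ℂ, p₂ x y ≠ 0 ∧ p₁ x y = lam * p₂ x y := by
  have hroot : ∃ t : ℂ,
      ((1 + (Real.sqrt 5 : ℂ)) / 2 - lam * ((1 - (Real.sqrt 5 : ℂ)) / 2)) * (t * t)
      + (lam * (2 - (Real.sqrt 5 : ℂ)) - (2 + (Real.sqrt 5 : ℂ))) * t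
      + ((11 + 5 * (Real.sqrt 5 : ℂ)) / 10 - lam * ((11 - 5 * (Real.sqrt 5 : ℂ)) / 10)) = 0 := by
    refine exists_root_quadratic _ fun ha hb => ofReal_sqrt_five_ne_zero ?_
    linear_combination (2 - (Real.sqrt 5 : ℂ)) * ha + (1 - (Real.sqrt 5 : ℂ)) / 2 * hb
  obtain ⟨t, ht⟩ := hroot
  obtain ⟨y, rfl⟩ := IsAlgClosed.exists_pow_nat_eq t two_pos
  have heq : p₁ 0 y = lam * p₂ 0 y := by
    unfold p₁ p₂
    linear_combination ht
  refine ⟨0, y, fun h₂ => p₁_ne_zero_of_p₂_eq_zero h₂ ?_, heq⟩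
  rw [heq, h₂, mul_zero]
end
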